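/- arXiv:2211.14937 — 9 statements merged into one kernel-verified Lean document; each statement's English description precedes it below -/
import Mathlib

section
/- Let p be a prime, n ≥ 1, and let σ be a linearly independent subset of (ZMod p)^n with |σ| = m+1. For every integer i with 0 ≤ i ≤ n−m−2, let N be the number of (i+1)-element subsets τ of (ZMod p)^n such that τ is disjoint from σ and σ ∪ τ is linearly independent over ZMod p. Then (i+1)! · N = ∏_{t=m+1}^{m+i+1} (p^n − p^t). -/
open Classical in
noncomputable def linkFaces (K : Type*) {V : Type*} [Field K] [AddCommGroup V] [Module K V]
    [Fintype V] [DecidableEq V] (σ : Finset V) (k : ℕ) : Finset (Finset V) :=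
  Finset.univ.filter fun τ => τ.card = k ∧ Disjoint σ τ ∧
    LinearIndepOn K id ((σ ∪ τ : Finset V) : Set V)

theorem mem_linkFaces {K V : Type*} [Field K] [AddCommGroup V] [Module K V]
    [Fintype V] [DecidableEq V] {σ τ : Finset V} {k : ℕ} :
    τ ∈ linkFaces K σ k ↔ τ.card = k ∧ Disjoint σ τ ∧
      LinearIndepOn K id ((σ ∪ τ : Finset V) : Set V) := by
  simp [linkFaces]

open Classical in
theorem linkFaces_step {K V : Type*} [Field K] [Fintype K] [AddCommGroup V] [Module K V]
    [Fintype V] [DecidableEq V] (σ : Finset V) (k : ℕ) :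
    (linkFaces K σ k).card * (Fintype.card V - Fintype.card K ^ (σ.card + k)) =
      (linkFaces K σ (k + 1)).card * (k + 1) := by
  refine Finset.card_mul_eq_card_mul (fun τ τ' => τ ⊆ τ') ?_ ?_
  · intro τ hτ
    obtain ⟨hc, hd, hli⟩ := mem_linkFaces.1 hτ
    set S := Submodule.span K ((σ ∪ τ : Finset V) : Set V) with hS
    have hsub : ∀ v ∉ S, v ∉ σ ∧ v ∉ τ := fun v hv =>
      ⟨fun h => hv (Submodule.subset_span (by simp [h])),
        fun h => hv (Submodule.subset_span (by simp [h]))⟩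
    have himg : Finset.bipartiteAbove (fun τ τ' => τ ⊆ τ') (linkFaces K σ (k + 1)) τ =
        (Finset.univ.filter fun v => v ∉ S).image (fun v => insert v τ) := by
      ext τ'
      simp only [Finset.mem_bipartiteAbove, Finset.mem_image, Finset.mem_filter,
        Finset.mem_univ, true_and, mem_linkFaces]
      constructor
      · rintro ⟨⟨hc', hd', hli'⟩, hss⟩
        have h1 : (τ' \ τ).card = 1 := by
          rw [Finset.card_sdiff_of_subset hss]; omega
        obtain ⟨v, hv⟩ := Finset.card_eq_one.1 h1
        have hvm : v ∈ τ' \ τ := by simp [hv]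
        rw [Finset.mem_sdiff] at hvm
        have heq : insert v τ = τ' := by
          rw [Finset.insert_eq, ← hv, Finset.sdiff_union_of_subset hss]
        refine ⟨v, ?_, heq⟩
        subst heq
        rw [Finset.union_insert, Finset.coe_insert, linearIndepOn_id_insert] at hli'
        · exact hli'.2
        · have := Finset.disjoint_right.1 hd' hvm.1
          simp [this, hvm.2]
      · rintro ⟨v, hv, rfl⟩
        obtain ⟨h1, h2⟩ := hsub v hv
        refine ⟨⟨by rw [Finset.card_insert_of_notMem h2, hc], ?_, ?_⟩, Finset.subset_insert _ _⟩
        · rw [Finset.disjoint_insert_right]; exact ⟨h1, hd⟩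
        · rw [Finset.union_insert, Finset.coe_insert, linearIndepOn_id_insert]
          · exact ⟨hli, hv⟩
          · simp [h1, h2]
    rw [himg, Finset.card_image_of_injOn]
    · have hfr : Module.finrank K S = σ.card + k := by
        rw [hS, finrank_span_finset_eq_card hli, Finset.card_union_of_disjoint hd, hc]
      have hSc : Fintype.card S = Fintype.card K ^ (σ.card + k) := by
        rw [← hfr]; exact Module.card_eq_pow_finrank
      rw [← hSc, Fintype.card_subtype, ← Finset.card_univ, ← Finset.compl_filter,
        Finset.card_compl, Finset.card_univ]
    · intro v hv w hw h
      have hv' := (hsub v (by simpa using hv)).2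
      have h' : insert v τ = insert w τ := h
      have : v ∈ insert w τ := by rw [← h']; simp
      rcases Finset.mem_insert.1 this with h | h
      · exact h
      · exact absurd h hv'
  · intro τ' hτ'
    obtain ⟨hc, hd, hli⟩ := mem_linkFaces.1 hτ'
    have : Finset.bipartiteBelow (fun τ τ' => τ ⊆ τ') (linkFaces K σ k) τ' =
        Finset.powersetCard k τ' := by
      ext τ
      simp only [Finset.mem_bipartiteBelow, Finset.mem_powersetCard, mem_linkFaces]
      constructor
      · rintro ⟨⟨h, -, -⟩, hs⟩; exact ⟨hs, h⟩
      · rintro ⟨hs, h⟩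
        refine ⟨⟨h, Finset.disjoint_of_subset_right hs hd, hli.mono ?_⟩, hs⟩
        exact_mod_cast Finset.union_subset_union_right hs
    rw [this, Finset.card_powersetCard, hc, Nat.choose_succ_self_right]

theorem linkFaces_card {K V : Type*} [Field K] [Fintype K] [AddCommGroup V] [Module K V]
    [Fintype V] [DecidableEq V] (σ : Finset V) (hσ : LinearIndepOn K id (σ : Set V)) (k : ℕ) :
    k.factorial * (linkFaces K σ k).card =
      ∏ t ∈ Finset.range k, (Fintype.card V - Fintype.card K ^ (σ.card + t)) := by
  induction k with
  | zero =>
    have : linkFaces K σ 0 = {∅} := by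
      ext τ
      rw [mem_linkFaces, Finset.card_eq_zero, Finset.mem_singleton]
      constructor
      · exact fun h => h.1
      · rintro rfl; simpa using hσ
    simp [this]
  | succ k ih =>
    rw [Finset.prod_range_succ, ← ih, mul_assoc, linkFaces_step, Nat.factorial_succ]
    ring

/-- `f`-vector of the link of an `m`-simplex `σ` in the universal complex `X(𝔽_p^n)`:
the number `N` of `(i+1)`-element sets `τ` of vectors, disjoint from `σ`, with `σ ∪ τ`
linearly independent, satisfies `(i+1)! · N = ∏_{t=m+1}^{m+i+1} (p^n − p^t)`. -/
theorem f_vector_link_X_Fpn (p : ℕ) (hp : p.Prime) (n m i : ℕ) (hn : 1 ≤ n)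
    (σ : Finset (Fin n → ZMod p)) (hσcard : σ.card = m + 1)
    (hσ : LinearIndependent (ZMod p)
      (fun x : (σ : Set (Fin n → ZMod p)) => (x : Fin n → ZMod p)))
    (hi : i ≤ n - m - 2) :
    (i + 1).factorial *
      Set.ncard {τ : Finset (Fin n → ZMod p) | τ.card = i + 1 ∧ Disjoint σ τ ∧
        LinearIndependent (ZMod p)
          (fun x : ((σ ∪ τ : Finset (Fin n → ZMod p)) : Set (Fin n → ZMod p)) =>
            (x : Fin n → ZMod p))} =
      ∏ t ∈ Finset.Icc (m + 1) (m + i + 1), (p ^ n - p ^ t) := by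
  haveI : Fact p.Prime := ⟨hp⟩
  have h := linkFaces_card (K := ZMod p) σ hσ (i + 1)
  have hset : {τ : Finset (Fin n → ZMod p) | τ.card = i + 1 ∧ Disjoint σ τ ∧
        LinearIndependent (ZMod p)
          (fun x : ((σ ∪ τ : Finset (Fin n → ZMod p)) : Set (Fin n → ZMod p)) =>
            (x : Fin n → ZMod p))} = (linkFaces (ZMod p) σ (i + 1) : Set _) := by
    ext τ
    rw [Finset.mem_coe, mem_linkFaces]
    rfl
  rw [hset, Set.ncard_coe_finset, h, hσcard, ← Finset.Ico_add_one_right_eq_Icc,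
    Finset.prod_Ico_eq_prod_range]
  have : m + i + 1 + 1 - (m + 1) = i + 1 := by omega
  simp [this, ZMod.card]
end

section
/- Let p be a prime, n ≥ 1, and let σ be a set of m+1 lines (points of the projectivization of (ZMod p)^n) forming an independent family (representative vectors are linearly independent over ZMod p). For every integer i with 0 ≤ i ≤ n−m−2, let N be the number of (i+1)-element sets τ of lines disjoint from σ such that σ ∪ τ is an independent family of points of the projectivization. Then (p−1)^{i+1} · (i+1)! · N = ∏_{t=m+1}^{m+i+1} (p^n − p^t). -/
open Projectivization in
lemma count_points_aux {p : ℕ} [Fact p.Prime] {n : ℕ}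
    (A : Finset (Projectivization (ZMod p) (Fin n → ZMod p)))
    (hA : LinearIndepOn (ZMod p) Projectivization.rep
      (A : Set (Projectivization (ZMod p) (Fin n → ZMod p))))
    (T : Finset (Projectivization (ZMod p) (Fin n → ZMod p)))
    (hT : ∀ x, x ∈ T ↔ x.rep ∉ Submodule.span (ZMod p) (Projectivization.rep ''
      (A : Set (Projectivization (ZMod p) (Fin n → ZMod p))))) :
    (p - 1) * T.card = p ^ n - p ^ A.card := by
  classical
  set W := Submodule.span (ZMod p) (Projectivization.rep ''
      (A : Set (Projectivization (ZMod p) (Fin n → ZMod p)))) with hW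
  have hfr : Module.finrank (ZMod p) W = A.card := by
    have h := finrank_span_eq_card (R := ZMod p) hA
    rw [← Set.image_eq_range] at h
    simpa using h
  have hc : Fintype.card W = p ^ A.card := by
    rw [Module.card_eq_pow_finrank (K := ZMod p), hfr, ZMod.card]
  have h1 : (Finset.univ.filter (fun v : Fin n → ZMod p => v ∉ W)).card
      = p ^ n - p ^ A.card := by
    rw [← hc, Fintype.card_subtype, ← Finset.compl_filter, Finset.card_compl]
    simp [ZMod.card]
  rw [← h1]
  have h2 : (Finset.univ : Finset (ZMod p)ˣ).card = p - 1 := by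
    rw [Finset.card_univ, ZMod.card_units]
  rw [← h2, ← Finset.card_product]
  refine Finset.card_bij (fun y _ => y.1 • y.2.rep) ?_ ?_ ?_
  · rintro ⟨u, x⟩ hx
    simp only [Finset.mem_product, hT, Finset.mem_univ, true_and, Finset.mem_filter] at hx ⊢
    rwa [Units.smul_def, Submodule.smul_mem_iff _ (Units.ne_zero _)]
  · rintro ⟨u, x⟩ hx ⟨w, y⟩ hy h
    simp only at h
    have hxy : x = y := by
      rw [← x.mk_rep, ← y.mk_rep, Projectivization.mk_eq_mk_iff]
      exact ⟨u⁻¹ * w, by rw [mul_smul, ← h, inv_smul_smul]⟩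
    subst hxy
    have : (u : ZMod p) = w := smul_left_injective (ZMod p) x.rep_nonzero h
    simp [Units.ext_iff, this]
  · intro v hv
    simp only [Finset.mem_filter, Finset.mem_univ, true_and] at hv
    have hv0 : v ≠ 0 := by rintro rfl; exact hv W.zero_mem
    obtain ⟨a, ha⟩ := exists_smul_eq_mk_rep (ZMod p) v hv0
    refine ⟨(a⁻¹, mk (ZMod p) v hv0), ?_, ?_⟩
    · simp only [Finset.mem_product, hT, Finset.mem_univ, true_and]
      rw [← ha]
      rwa [Units.smul_def, Submodule.smul_mem_iff _ (Units.ne_zero _)]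
    · simp only
      rw [← ha, inv_smul_smul]

lemma link_count_aux {p : ℕ} [Fact p.Prime] {n m : ℕ}
    (σ : Finset (Projectivization (ZMod p) (Fin n → ZMod p))) (hσcard : σ.card = m + 1)
    (hσ : LinearIndepOn (ZMod p) Projectivization.rep
      (σ : Set (Projectivization (ZMod p) (Fin n → ZMod p))))
    (S : ℕ → Finset (Finset (Projectivization (ZMod p) (Fin n → ZMod p))))
    (hS : ∀ k τ, τ ∈ S k ↔ τ.card = k ∧ Disjoint σ τ ∧
      LinearIndepOn (ZMod p) Projectivization.rep
      ((σ : Set (Projectivization (ZMod p) (Fin n → ZMod p))) ∪ τ)) (k : ℕ) :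
    (p - 1) ^ k * k.factorial * (S k).card = ∏ t ∈ Finset.Ico (m + 1) (m + 1 + k),
      (p ^ n - p ^ t) := by
  classical
  have : Fintype (Projectivization (ZMod p) (Fin n → ZMod p)) := Fintype.ofFinite _
  induction k with
  | zero =>
    have : S 0 = {∅} := by
      ext τ
      rw [hS, Finset.mem_singleton, Finset.card_eq_zero]
      refine ⟨fun h => h.1, ?_⟩
      rintro rfl
      simpa using hσ
    simp [this]
  | succ k ih =>
    rw [← add_assoc, Finset.prod_Ico_succ_top (by omega), ← ih]
    have key : (p - 1) * ((S (k + 1)).card * (k + 1)) =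
        (S k).card * (p ^ n - p ^ (m + 1 + k)) := by
      have hdc := Finset.sum_card_bipartiteAbove_eq_sum_card_bipartiteBelow
        (s := S k) (t := S (k + 1)) (fun a b => a ⊆ b)
      have hb : ∀ b ∈ S (k + 1),
          (Finset.bipartiteBelow (fun a b => a ⊆ b) (S k) b).card = k + 1 := by
        intro b hb
        rw [hS] at hb
        have : Finset.bipartiteBelow (fun a b => a ⊆ b) (S k) b = b.powersetCard k := by
          ext a
          simp only [Finset.mem_bipartiteBelow, Finset.mem_powersetCard, hS]
          constructor
          · rintro ⟨h1, h2⟩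
            exact ⟨h2, h1.1⟩
          · rintro ⟨h1, h2⟩
            refine ⟨⟨h2, hb.2.1.mono_right h1, hb.2.2.mono ?_⟩, h1⟩
            exact Set.union_subset_union_right _ (by exact_mod_cast h1)
        rw [this, Finset.card_powersetCard, hb.1]
        simp
      have ha : ∀ a ∈ S k,
          (p - 1) * (Finset.bipartiteAbove (fun a b => a ⊆ b) (S (k + 1)) a).card
            = p ^ n - p ^ (m + 1 + k) := by
        intro a ha
        rw [hS] at ha
        obtain ⟨hac, had, hai⟩ := ha
        have hcard : (σ ∪ a).card = m + 1 + k := by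
          rw [Finset.card_union_of_disjoint had, hσcard, hac]
        rw [← Finset.coe_union] at hai
        set T := Finset.univ.filter (fun x : Projectivization (ZMod p) (Fin n → ZMod p) =>
          x.rep ∉ Submodule.span (ZMod p) (Projectivization.rep ''
            ((σ ∪ a : Finset _) : Set (Projectivization (ZMod p) (Fin n → ZMod p))))) with hT
        have hTm : ∀ x ∈ T, x ∉ σ ∪ a := by
          intro x hx hx'
          rw [hT, Finset.mem_filter] at hx
          exact hx.2 (Submodule.subset_span ⟨x, by exact_mod_cast hx', rfl⟩)
        rw [← hcard, ← count_points_aux (σ ∪ a) hai T (by simp [hT])]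
        congr 1
        symm
        refine Finset.card_bij (fun x _ => insert x a) ?_ ?_ ?_
        · intro x hx
          have hxn := hTm x hx
          rw [Finset.mem_union, not_or] at hxn
          rw [hT, Finset.mem_filter] at hx
          rw [Finset.mem_bipartiteAbove, hS]
          refine ⟨⟨by rw [Finset.card_insert_of_notMem hxn.2, hac], ?_, ?_⟩,
            Finset.subset_insert _ _⟩
          · rw [Finset.disjoint_insert_right]
            exact ⟨hxn.1, had⟩
          · rw [Finset.coe_insert, Set.union_insert, ← Finset.coe_union]
            exact hai.insert hx.2
        · intro x hx y hy h
          have hxn := hTm x hx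
          rw [Finset.mem_union, not_or] at hxn
          have : x ∈ insert y a := by rw [← h]; exact Finset.mem_insert_self _ _
          rcases Finset.mem_insert.1 this with h | h
          · exact h
          · exact absurd h hxn.2
        · intro b hb
          rw [Finset.mem_bipartiteAbove, hS] at hb
          obtain ⟨⟨hbc, hbd, hbi⟩, hab⟩ := hb
          obtain ⟨x, hxa, hxb⟩ := (Finset.exists_eq_insert_iff (s := a) (t := b)).2
            ⟨hab, by rw [hac, hbc]⟩
          subst hxb
          refine ⟨x, ?_, rfl⟩
          have hxσ : x ∉ σ := (Finset.disjoint_insert_right.1 hbd).1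
          rw [Finset.coe_insert, Set.union_insert, ← Finset.coe_union,
            linearIndepOn_insert (by
              rw [Finset.mem_coe, Finset.mem_union]; tauto)] at hbi
          rw [hT, Finset.mem_filter]
          exact ⟨Finset.mem_univ _, hbi.2⟩
      rw [Finset.sum_congr rfl hb, Finset.sum_const, smul_eq_mul] at hdc
      rw [← hdc, Finset.mul_sum, Finset.sum_congr rfl ha, Finset.sum_const, smul_eq_mul]
    rw [Nat.factorial_succ, pow_succ]
    calc _ = (p - 1) ^ k * k.factorial * ((p - 1) * ((S (k + 1)).card * (k + 1))) := by ring
      _ = _ := by rw [key]; ring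

/-- `f`-vector of the link of an `m`-simplex `σ` in the universal complex `K(𝔽_p^n)`:
the number `N` of `(i+1)`-element sets `τ` of lines, disjoint from `σ`, with `σ ∪ τ`
an independent family of points of the projectivization, satisfies
`(p−1)^{i+1} · (i+1)! · N = ∏_{t=m+1}^{m+i+1} (p^n − p^t)`. -/
theorem f_vector_link_K_Fpn (p : ℕ) [Fact p.Prime] (n m i : ℕ) (hn : 1 ≤ n)
    (σ : Finset (Projectivization (ZMod p) (Fin n → ZMod p))) (hσcard : σ.card = m + 1)
    (hσ : Projectivization.Independent
      (fun x : (σ : Set (Projectivization (ZMod p) (Fin n → ZMod p))) =>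
        (x : Projectivization (ZMod p) (Fin n → ZMod p))))
    (hi : i ≤ n - m - 2) :
    (p - 1) ^ (i + 1) * (i + 1).factorial *
      Set.ncard {τ : Finset (Projectivization (ZMod p) (Fin n → ZMod p)) | τ.card = i + 1 ∧
        Disjoint σ τ ∧
        Projectivization.Independent
          (fun x : (((σ : Set (Projectivization (ZMod p) (Fin n → ZMod p))) ∪
              (τ : Set (Projectivization (ZMod p) (Fin n → ZMod p))) :
                Set (Projectivization (ZMod p) (Fin n → ZMod p)))) =>
            (x : Projectivization (ZMod p) (Fin n → ZMod p)))} =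
      ∏ t ∈ Finset.Icc (m + 1) (m + i + 1), (p ^ n - p ^ t) := by
  classical
  have : Fintype (Projectivization (ZMod p) (Fin n → ZMod p)) := Fintype.ofFinite _
  rw [Projectivization.independent_iff] at hσ
  have h := link_count_aux σ hσcard hσ
    (fun k => Finset.univ.filter (fun τ => τ.card = k ∧ Disjoint σ τ ∧
      LinearIndepOn (ZMod p) Projectivization.rep
      ((σ : Set (Projectivization (ZMod p) (Fin n → ZMod p))) ∪ τ)))
    (by intro k τ; simp) (i + 1)
  have hI : Finset.Icc (m + 1) (m + i + 1) = Finset.Ico (m + 1) (m + 1 + (i + 1)) := by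
    ext t
    simp only [Finset.mem_Icc, Finset.mem_Ico]
    omega
  rw [hI, ← h, ← Set.ncard_coe_finset]
  congr 2
  ext τ
  simp only [Set.mem_setOf_eq, Finset.coe_filter, Finset.mem_univ, true_and,
    Projectivization.independent_iff]
  rfl
end

section
/- Let p be a prime and let n ≥ 2 and 2 ≤ j ≤ n be integers. Let N be the number of (j+1)-element subsets A of (ZMod p)^n \ {0} such that A is linearly dependent over ZMod p while every proper subset of A is linearly independent. Then (j+1)! · N = (p−1)^j · ∏_{t=0}^{j−1} (p^n − p^t). -/
/-- Ordered circuits. -/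
def OrdCirc (K : Type*) {V : Type*} [Field K] [AddCommGroup V] [Module K V] {j : ℕ}
    (f : Fin (j + 1) → V) : Prop :=
  ¬ LinearIndependent K f ∧ ∀ i : Fin (j + 1), LinearIndependent K (fun k => f (i.succAbove k))

theorem OrdCirc.inj {K V : Type*} [Field K] [AddCommGroup V] [Module K V] {j : ℕ} (hj : 2 ≤ j)
    {f : Fin (j + 1) → V} (h : OrdCirc K f) : Function.Injective f := by
  intro k l hkl
  by_contra hne
  obtain ⟨m, hm⟩ : ∃ m : Fin (j + 1), m ∉ ({k, l} : Finset (Fin (j + 1))) := by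
    by_contra! hc
    have h1 : (Finset.univ : Finset (Fin (j + 1))) ⊆ {k, l} := fun x _ => hc x
    have h2 := Finset.card_le_card h1
    have h3 := Finset.card_le_two (a := k) (b := l)
    simp only [Finset.card_univ, Fintype.card_fin] at h2
    omega
  simp only [Finset.mem_insert, Finset.mem_singleton, not_or] at hm
  obtain ⟨a, rfl⟩ := Fin.exists_succAbove_eq (Ne.symm hm.1)
  obtain ⟨b, rfl⟩ := Fin.exists_succAbove_eq (Ne.symm hm.2)
  exact hne (congrArg _ ((h.2 m).injective hkl))

theorem ordCirc_iff {K V : Type*} [Field K] [AddCommGroup V] [Module K V] {j : ℕ}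
    (f : Fin (j + 1) → V) :
    OrdCirc K f ↔ LinearIndependent K (Fin.tail f) ∧
      ∃ c : Fin j → Kˣ, f 0 = ∑ i, (c i : K) • f i.succ := by
  constructor
  · rintro ⟨h1, h2⟩
    have ht : LinearIndependent K (Fin.tail f) := by
      have := h2 0
      simp only [Fin.zero_succAbove] at this
      exact this
    refine ⟨ht, ?_⟩
    have h0 : f 0 ∈ Submodule.span K (Set.range (Fin.tail f)) := by
      by_contra hc
      apply h1
      rw [← Fin.cons_self_tail f, linearIndependent_finCons]
      exact ⟨ht, hc⟩
    obtain ⟨c, hc⟩ := (Submodule.mem_span_range_iff_exists_fun K).1 h0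
    have hne : ∀ i, c i ≠ 0 := by
      intro i hi
      let g : Fin (j + 1) → K := Fin.cons (-1) c
      have hg : ∑ k, g k • f k = 0 := by
        rw [Fin.sum_univ_succ]
        simp only [g, Fin.cons_zero, Fin.cons_succ]
        rw [← hc]
        simp [Fin.tail]
      rw [Fin.sum_univ_succAbove _ i.succ] at hg
      have hgi : g i.succ = 0 := by simpa [g] using hi
      rw [hgi, zero_smul, zero_add] at hg
      have h3 := Fintype.linearIndependent_iff.1 (h2 i.succ) (fun k => g (i.succ.succAbove k)) hg
      obtain ⟨a, ha⟩ := Fin.exists_succAbove_eq (Fin.succ_ne_zero i).symm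
      have h4 := h3 a
      rw [ha] at h4
      simp [g] at h4
    exact ⟨fun i => Units.mk0 (c i) (hne i), by simpa [Fin.tail] using hc.symm⟩
  · rintro ⟨ht, c, hc⟩
    have key : ∀ g : Fin (j + 1) → K, ∑ k, g k • f k = 0 →
        ∀ i : Fin j, g 0 * c i + g i.succ = 0 := by
      intro g hg
      rw [Fin.sum_univ_succ, hc, Finset.smul_sum, ← Finset.sum_add_distrib] at hg
      apply Fintype.linearIndependent_iff.1 ht
      rw [← hg]
      refine Finset.sum_congr rfl fun i _ => ?_
      simp [Fin.tail, add_smul, mul_smul]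
    constructor
    · intro h
      have h3 := Fintype.linearIndependent_iff.1 h (Fin.cons (-1) (fun i => (c i : K))) (by
        rw [Fin.sum_univ_succ]
        simp only [Fin.cons_zero, Fin.cons_succ]
        rw [hc]
        simp) 0
      simp at h3
    · intro i
      rw [Fintype.linearIndependent_iff]
      intro g hg
      have hk := key (i.insertNth 0 g) (by
        rw [Fin.sum_univ_succAbove _ i]
        simpa using hg)
      set G : Fin (j + 1) → K := i.insertNth 0 g with hG
      have hGi : G i = 0 := by simp [hG]
      have h0 : G 0 = 0 := by
        rcases Fin.eq_zero_or_eq_succ i with rfl | ⟨m, rfl⟩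
        · exact hGi
        · have := hk m
          rw [hGi, add_zero] at this
          simpa using this
      have hall : ∀ k, G k = 0 := by
        intro k
        rcases Fin.eq_zero_or_eq_succ k with rfl | ⟨m, rfl⟩
        · exact h0
        · have := hk m
          rwa [h0, zero_mul, zero_add] at this
      intro k
      have := hall (i.succAbove k)
      simpa [hG] using this

theorem card_ordCirc {K V : Type*} [Field K] [AddCommGroup V] [Module K V] [Fintype K] [Finite V]
    {j : ℕ} (hj : j ≤ Module.finrank K V) :
    Nat.card {f : Fin (j + 1) → V // OrdCirc K f} =
      (Fintype.card K - 1) ^ j *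
        ∏ t ∈ Finset.range j, (Fintype.card K ^ Module.finrank K V - Fintype.card K ^ t) := by
  classical
  have := Fintype.ofFinite V
  let Φ : (Fin j → Kˣ) × {s : Fin j → V // LinearIndependent K s} →
      {f : Fin (j + 1) → V // OrdCirc K f} := fun x =>
    ⟨Fin.cons (∑ i, (x.1 i : K) • x.2.1 i) x.2.1, by
      rw [ordCirc_iff]
      refine ⟨by simpa using x.2.2, x.1, by simp⟩⟩
  have hΦ : Function.Bijective Φ := by
    constructor
    · rintro ⟨c, s, hs⟩ ⟨d, t, ht⟩ h
      have h := congrArg Subtype.val h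
      simp only [Φ, Fin.cons_inj] at h
      obtain ⟨h, rfl⟩ := h
      have h' : ∑ i, ((c i : K) - d i) • s i = 0 := by
        simp only [sub_smul, Finset.sum_sub_distrib, h, sub_self]
      have h3 := Fintype.linearIndependent_iff.1 hs _ h'
      have : c = d := by
        funext i
        exact Units.ext (sub_eq_zero.1 (h3 i))
      rw [this]
    · rintro ⟨f, hf⟩
      obtain ⟨ht, c, hc⟩ := (ordCirc_iff f).1 hf
      refine ⟨⟨c, ⟨Fin.tail f, ht⟩⟩, Subtype.ext ?_⟩
      simp only [Φ]
      conv_rhs => rw [← Fin.cons_self_tail f, hc]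
      rfl
  rw [← Nat.card_eq_of_bijective Φ hΦ, Nat.card_prod, card_linearIndependent hj,
    Nat.card_eq_fintype_card, Fintype.card_fun, Fintype.card_units, Fintype.card_fin,
    Finset.prod_range]

theorem range_coe_li {K V ι : Type*} [Field K] [AddCommGroup V] [Module K V] {f : ι → V}
    (hf : Function.Injective f) :
    LinearIndependent K (fun x : Set.range f => (x : V)) ↔ LinearIndependent K f :=
  (linearIndependent_equiv' (Equiv.ofInjective f hf) rfl).symm

theorem image_iff {K V : Type*} [Field K] [AddCommGroup V] [Module K V] [DecidableEq V]
    {j : ℕ} (hj : 2 ≤ j) (f : Fin (j + 1) → V) (hf : Function.Injective f) :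
    OrdCirc K f ↔ ((0 : V) ∉ Finset.univ.image f ∧ (Finset.univ.image f).card = j + 1 ∧
      ¬ LinearIndependent K (fun x : ((Finset.univ.image f : Finset V) : Set V) => (x : V)) ∧
        ∀ B ⊂ Finset.univ.image f, LinearIndependent K (fun x : (B : Set V) => (x : V))) := by
  have hA : LinearIndependent K
      (fun x : ((Finset.univ.image f : Finset V) : Set V) => (x : V)) ↔ LinearIndependent K f := by
    rw [Finset.coe_image, Finset.coe_univ, Set.image_univ]
    exact range_coe_li hf
  have hB : ∀ i : Fin (j + 1),
      LinearIndependent K (fun x : (((Finset.univ.image f).erase (f i) : Finset V) : Set V) =>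
        (x : V)) ↔ LinearIndependent K (fun k => f (i.succAbove k)) := by
    intro i
    have : (((Finset.univ.image f).erase (f i) : Finset V) : Set V) =
        Set.range (fun k => f (i.succAbove k)) := by
      ext x
      simp only [Finset.coe_erase, Finset.coe_image, Finset.coe_univ, Set.image_univ,
        Set.mem_sdiff, Set.mem_range, Set.mem_singleton_iff]
      constructor
      · rintro ⟨⟨k, rfl⟩, h⟩
        obtain ⟨a, rfl⟩ := Fin.exists_succAbove_eq (fun e : k = i => h (congrArg f e))
        exact ⟨a, rfl⟩
      · rintro ⟨k, rfl⟩
        exact ⟨⟨_, rfl⟩, fun h => Fin.succAbove_ne i k (hf h)⟩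
    rw [this]
    exact range_coe_li (hf.comp Fin.succAbove_right_injective)
  rw [hA]
  constructor
  · rintro ⟨h1, h2⟩
    refine ⟨?_, ?_, h1, ?_⟩
    · intro h
      obtain ⟨k, -, hk⟩ := Finset.mem_image.1 h
      have : Nontrivial (Fin (j + 1)) := Fin.nontrivial_iff_two_le.2 (by omega)
      obtain ⟨m, hm⟩ := exists_ne k
      obtain ⟨a, rfl⟩ := Fin.exists_succAbove_eq hm.symm
      exact (h2 m).ne_zero a hk
    · rw [Finset.card_image_of_injective _ hf]; simp
    · intro B hBA
      obtain ⟨x, hx, hxB⟩ := Finset.exists_of_ssubset hBA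
      obtain ⟨i, -, rfl⟩ := Finset.mem_image.1 hx
      have h3 := (hB i).2 (h2 i)
      refine LinearIndepOn.mono (v := id) (R := K) h3 ?_
      intro y hy
      simp only [Finset.mem_coe] at hy
      rw [Finset.mem_coe, Finset.mem_erase]
      exact ⟨fun e => hxB (e ▸ hy), hBA.1 hy⟩
  · rintro ⟨-, -, h1, h2⟩
    exact ⟨h1, fun i => (hB i).1 (h2 _ (Finset.erase_ssubset (by simp)))⟩

theorem card_fiber {V : Type*} [DecidableEq V] [Fintype V] {m : ℕ} (A : Finset V)
    (hA : A.card = m) :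
    (Finset.univ.filter (fun f : Fin m → V => Function.Injective f ∧ Finset.univ.image f = A)).card
      = m.factorial := by
  have h1 : Fintype.card (Fin m ≃ A) = m.factorial := by
    rw [Fintype.card_equiv (A.equivFinOfCardEq hA).symm, Fintype.card_fin]
  rw [← h1, ← Finset.card_univ]
  symm
  refine Finset.card_bij (fun e _ => fun k => (e k : V)) ?_ ?_ ?_
  · intro e _
    simp only [Finset.mem_filter, Finset.mem_univ, true_and]
    refine ⟨Subtype.val_injective.comp e.injective, ?_⟩
    ext x
    simp only [Finset.mem_image, Finset.mem_univ, true_and]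
    constructor
    · rintro ⟨k, rfl⟩
      exact (e k).2
    · intro hx
      exact ⟨e.symm ⟨x, hx⟩, by simp⟩
  · intro e _ e' _ h
    ext k
    exact congrFun h k
  · intro f hf
    simp only [Finset.mem_filter, Finset.mem_univ, true_and] at hf
    obtain ⟨hi, hA'⟩ := hf
    have hm : ∀ k, f k ∈ A := fun k => hA' ▸ Finset.mem_image_of_mem f (Finset.mem_univ k)
    refine ⟨Equiv.ofBijective (fun k => (⟨f k, hm k⟩ : A)) ⟨?_, ?_⟩, Finset.mem_univ _, rfl⟩
    · intro a b h
      exact hi (congrArg Subtype.val h)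
    · rintro ⟨x, hx⟩
      rw [← hA'] at hx
      obtain ⟨k, -, rfl⟩ := Finset.mem_image.1 hx
      exact ⟨k, rfl⟩

/-- The number `N` of minimal `j`-nonsimplices of the universal complex `X(𝔽_p^n)`
(for `j ≥ 2`) satisfies `(j+1)! · N = (p−1)^j · ∏_{t=0}^{j−1} (p^n − p^t)`. -/
theorem count_minimal_j_nonsimplices
    (p : ℕ) (hp : p.Prime) (n j : ℕ) (hn : 2 ≤ n) (hj : 2 ≤ j) (hjn : j ≤ n) :
    (j + 1).factorial *
      Set.ncard {A : Finset (Fin n → ZMod p) | (0 : Fin n → ZMod p) ∉ A ∧ A.card = j + 1 ∧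
        ¬ LinearIndependent (ZMod p)
            (fun x : (A : Set (Fin n → ZMod p)) => (x : Fin n → ZMod p)) ∧
        ∀ B ⊂ A, LinearIndependent (ZMod p)
            (fun x : (B : Set (Fin n → ZMod p)) => (x : Fin n → ZMod p))} =
      (p - 1) ^ j * ∏ t ∈ Finset.range j, (p ^ n - p ^ t) := by
  classical
  have : Fact p.Prime := ⟨hp⟩
  have : NeZero p := ⟨hp.ne_zero⟩
  set S : Set (Finset (Fin n → ZMod p)) := {A | _} with hS
  have hc := card_ordCirc (K := ZMod p) (V := Fin n → ZMod p) (j := j) (by simpa using hjn)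
  simp only [ZMod.card, Module.finrank_fin_fun] at hc
  rw [← hc, Nat.card_eq_fintype_card, Fintype.card_subtype, Set.ncard_eq_toFinset_card']
  rw [Finset.card_eq_sum_card_fiberwise (f := fun f => Finset.univ.image f) (t := S.toFinset)]
  · rw [Finset.sum_const_nat (m := (j + 1).factorial), mul_comm]
    intro A hA
    rw [Set.mem_toFinset] at hA
    rw [← card_fiber A hA.2.1, Finset.filter_filter]
    congr 1
    ext f
    simp only [Finset.mem_filter, Finset.mem_univ, true_and]
    constructor
    · rintro ⟨h, h'⟩
      exact ⟨h.inj hj, h'⟩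
    · rintro ⟨h, rfl⟩
      exact ⟨(image_iff hj f h).2 hA, rfl⟩
  · intro f hf
    have hf : OrdCirc (ZMod p) f := by simpa using hf
    rw [Finset.mem_coe, Set.mem_toFinset]
    exact (image_iff hj f (hf.inj hj)).1 hf
end

section
/- Let p and q be primes and m, n ≥ 1 integers. Suppose there exists a function f from the projectivization of (ZMod p)^m to the projectivization of (ZMod q)^n such that for every k and every independent family v : Fin k → ℙ((ZMod p)^m), the family f ∘ v is independent. Then m ≤ n, and for every i ≥ 0 the number of (i+1)-element independent subsets of ℙ((ZMod p)^m) is at most the number of (i+1)-element independent subsets of ℙ((ZMod q)^n). -/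
/-- If there is a nondegenerate map from `K(𝔽_p^m)` to `K(𝔽_q^n)`, then `m ≤ n` and
each face number of `K(𝔽_p^m)` is at most the corresponding face number of
`K(𝔽_q^n)`. -/
theorem nondegenerate_map_K_consequences (p q : ℕ) [Fact p.Prime] [Fact q.Prime]
    (m n : ℕ) (hm : 1 ≤ m) (hn : 1 ≤ n)
    (hf : ∃ f : Projectivization (ZMod p) (Fin m → ZMod p) →
        Projectivization (ZMod q) (Fin n → ZMod q),
      ∀ (k : ℕ) (v : Fin k → Projectivization (ZMod p) (Fin m → ZMod p)),
        Projectivization.Independent v → Projectivization.Independent (f ∘ v)) :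
    m ≤ n ∧ ∀ i : ℕ,
      Set.ncard {S : Finset (Projectivization (ZMod p) (Fin m → ZMod p)) |
          S.card = i + 1 ∧ Projectivization.Independent
            (fun x : (S : Set (Projectivization (ZMod p) (Fin m → ZMod p))) =>
              (x : Projectivization (ZMod p) (Fin m → ZMod p)))} ≤
      Set.ncard {S : Finset (Projectivization (ZMod q) (Fin n → ZMod q)) |
          S.card = i + 1 ∧ Projectivization.Independent
            (fun x : (S : Set (Projectivization (ZMod q) (Fin n → ZMod q))) =>
              (x : Projectivization (ZMod q) (Fin n → ZMod q)))} := by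
  classical
  obtain ⟨f, hf⟩ := hf
  have hinj : Function.Injective f := by
    intro a b hab
    by_contra hne
    have h1 := hf 2 ![a, b] ((Projectivization.independent_pair_iff_ne a b).2 hne)
    have h2 : f ∘ ![a, b] = ![f a, f b] := by
      ext i; fin_cases i <;> rfl
    rw [h2, Projectivization.independent_pair_iff_ne] at h1
    exact h1 hab
  refine ⟨?_, fun i => ?_⟩
  · have hb := (Pi.basisFun (ZMod p) (Fin m)).linearIndependent
    have h1 := hf m _ (Projectivization.Independent.mk _ (fun i => hb.ne_zero i) hb)
    rw [Projectivization.independent_iff] at h1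
    simpa using h1.fintype_card_le_finrank
  · have : Finite (Projectivization (ZMod q) (Fin n → ZMod q)) := inferInstance
    refine Set.ncard_le_ncard_of_injOn (fun S => S.map ⟨f, hinj⟩) ?_
      ((Finset.map_injective _).injOn) (Set.toFinite _)
    rintro S ⟨hc, hS⟩
    refine ⟨by simpa using hc, ?_⟩
    let e : Fin (i + 1) ≃ S := (S.equivFinOfCardEq hc).symm
    have h1 := hf (i + 1) (fun j => (e j).1) (by
      rw [Projectivization.independent_iff] at hS ⊢
      exact hS.comp (fun j => e j) e.injective)
    rw [Projectivization.independent_iff] at h1 ⊢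
    let g : ((S.map ⟨f, hinj⟩ : Finset _) : Set (Projectivization (ZMod q) (Fin n → ZMod q))) →
        Fin (i + 1) := fun y => e.symm ⟨(Finset.mem_map.1 y.2).choose,
          (Finset.mem_map.1 y.2).choose_spec.1⟩
    have hg : ∀ y, f (e (g y)).1 = y.1 := by
      intro y
      simp only [g, Equiv.apply_symm_apply]
      exact (Finset.mem_map.1 y.2).choose_spec.2
    have hginj : Function.Injective g := by
      intro y z hyz
      apply Subtype.ext
      rw [← hg y, ← hg z, hyz]
    have h2 := h1.comp g hginj
    convert h2 using 1
    funext y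
    simp only [Function.comp_apply, hg]
end

section
/- Let p and q be primes and n, r ≥ 1 integers. If there exists a function f from the projectivization of (ZMod p)^n to the projectivization of (ZMod q)^r such that for every k and every independent family v : Fin k → ℙ((ZMod p)^n), the family f ∘ v is independent, then (p − 1)(q^r − 1) ≥ (q − 1)(p^n − 1); equivalently, the number (q^r − 1)/(q − 1) of lines in (ZMod q)^r is at least the number (p^n − 1)/(p − 1) of lines in (ZMod p)^n, so that r ≥ ⌈log_q((q−1)(p^n−1)/(p−1) + 1)⌉. -/
/-- Lower bound for `ω_{p,q}(n)`: if there is a nondegenerate map from `K(𝔽_p^n)` to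
`K(𝔽_q^r)`, then `(q−1)(p^n−1) ≤ (p−1)(q^r−1)` (the number of lines in `(ZMod q)^r`
is at least the number of lines in `(ZMod p)^n`), and hence
`r ≥ ⌈log_q((q−1)(p^n−1)/(p−1) + 1)⌉`. -/
theorem omega_lower_bound (p q n r : ℕ) [Fact p.Prime] [Fact q.Prime]
    (hn : 1 ≤ n) (hr : 1 ≤ r)
    (hf : ∃ f : Projectivization (ZMod p) (Fin n → ZMod p) →
        Projectivization (ZMod q) (Fin r → ZMod q),
      ∀ (k : ℕ) (v : Fin k → Projectivization (ZMod p) (Fin n → ZMod p)),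
        Projectivization.Independent v → Projectivization.Independent (f ∘ v)) :
    (q - 1) * (p ^ n - 1) ≤ (p - 1) * (q ^ r - 1) ∧
      Nat.clog q ((q - 1) * (p ^ n - 1) / (p - 1) + 1) ≤ r := by
  obtain ⟨f, hf⟩ := hf
  have hinj : Function.Injective f := by
    intro u v huv
    by_contra hne
    have h := hf 2 ![u, v] ((Projectivization.independent_pair_iff_ne u v).2 hne)
    have e : f ∘ ![u, v] = ![f u, f v] := by
      funext i
      fin_cases i <;> rfl
    rw [e, Projectivization.independent_pair_iff_ne] at h
    exact h huv
  have hp : 1 < p := (Fact.out : p.Prime).one_lt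
  have hq : 1 < q := (Fact.out : q.Prime).one_lt
  have hle := Nat.card_le_card_of_injective f hinj
  have h1 := Projectivization.card (ZMod p) (Fin n → ZMod p)
  have h2 := Projectivization.card (ZMod q) (Fin r → ZMod q)
  simp only [Nat.card_fun, Nat.card_zmod, Nat.card_fin] at h1 h2
  have key : (q - 1) * (p ^ n - 1) ≤ (p - 1) * (q ^ r - 1) := by
    rw [h1, h2]
    calc _ = Nat.card (Projectivization (ZMod p) (Fin n → ZMod p)) * ((p - 1) * (q - 1)) := by ring
      _ ≤ Nat.card (Projectivization (ZMod q) (Fin r → ZMod q)) * ((p - 1) * (q - 1)) :=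
        Nat.mul_le_mul_right _ hle
      _ = _ := by ring
  refine ⟨key, ?_⟩
  have hd : (q - 1) * (p ^ n - 1) / (p - 1) ≤ q ^ r - 1 := Nat.div_le_of_le_mul key
  have hpos : 0 < q ^ r := Nat.pow_pos (by omega)
  exact Nat.clog_le_of_le_pow (by omega)
end

section
/- Let p and q be primes and n ≥ 1 an integer, and set M = (p^n − 1)/(p − 1) (the number of lines in (ZMod p)^n). Then there exists a function f from the projectivization of (ZMod p)^n to the projectivization of (ZMod q)^M such that for every k and every independent family v : Fin k → ℙ((ZMod p)^n), the family f ∘ v is independent. Hence ω_{p,q}(n) ≤ (p^n − 1)/(p − 1). -/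
/-- Upper bound for `ω_{p,q}(n)`: with `M = (p^n − 1)/(p − 1)` the number of lines of
`(ZMod p)^n`, there is a nondegenerate map from `K(𝔽_p^n)` to `K(𝔽_q^M)`, i.e. a map
of projectivizations sending independent families to independent families. -/
theorem omega_upper_bound (p q n : ℕ) [Fact p.Prime] [Fact q.Prime] (hn : 1 ≤ n) :
    ∃ f : Projectivization (ZMod p) (Fin n → ZMod p) →
        Projectivization (ZMod q) (Fin ((p ^ n - 1) / (p - 1)) → ZMod q),
      ∀ (k : ℕ) (v : Fin k → Projectivization (ZMod p) (Fin n → ZMod p)),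
        Projectivization.Independent v → Projectivization.Independent (f ∘ v) := by
  have hcard : Nat.card (Projectivization (ZMod p) (Fin n → ZMod p))
      = (p ^ n - 1) / (p - 1) := by
    rw [Projectivization.card'']
    simp
  let e := Finite.equivFinOfCardEq hcard
  have hb := (Pi.basisFun (ZMod q) (Fin ((p ^ n - 1) / (p - 1)))).linearIndependent
  refine ⟨fun x => Projectivization.mk (ZMod q) _ (hb.ne_zero (e x)), ?_⟩
  intro k v hv
  have hinj : Function.Injective v :=
    Function.Injective.of_comp (Projectivization.independent_iff.1 hv).injective
  exact Projectivization.Independent.mk _ (fun i => hb.ne_zero (e (v i)))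
    (hb.comp (fun i => e (v i)) (e.injective.comp hinj))
end

section
/- Let p be a prime and let G be a simple graph on a finite nonempty vertex set V whose chromatic number is the natural number γ ≥ 1. Then the least natural number r such that there exists a function f from V to the projectivization of (ZMod p)^r with f(u) ≠ f(v) whenever u and v are adjacent in G is equal to ⌈log_p((p − 1)·γ + 1)⌉ (the ceiling logarithm Nat.clog p ((p−1)·γ + 1)). Equivalently, the mod p Buchstaber invariant of G (viewed as a 1-dimensional simplicial complex on m vertices) equals m − ⌈log_p((p − 1)·γ(G) + 1)⌉. -/
/-- Mod `p` Buchstaber invariant of a simple graph: the least `r` such that there is a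
map from the vertices of `G` to the projectivization of `(ZMod p)^r` sending adjacent
vertices to distinct lines (i.e. a nondegenerate simplicial map `G → K(𝔽_p^r)`) equals
`⌈log_p((p−1)·γ(G)+1)⌉`. -/
theorem graph_buchstaber_invariant (p : ℕ) [Fact p.Prime]
    (V : Type) [Fintype V] [Nonempty V] (G : SimpleGraph V)
    (γ : ℕ) (hγ1 : 1 ≤ γ) (hγ : G.chromaticNumber = γ) :
    IsLeast {r : ℕ | ∃ f : V → Projectivization (ZMod p) (Fin r → ZMod p),
        ∀ u v : V, G.Adj u v → f u ≠ f v}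
      (Nat.clog p ((p - 1) * γ + 1)) := by
  have hp : p.Prime := Fact.out
  have key : ∀ r : ℕ, (∃ f : V → Projectivization (ZMod p) (Fin r → ZMod p),
        ∀ u v : V, G.Adj u v → f u ≠ f v) ↔ Nat.clog p ((p - 1) * γ + 1) ≤ r := by
    intro r
    have hfin : Finite (Projectivization (ZMod p) (Fin r → ZMod p)) :=
      (Projectivization.finite_iff_of_finite (ZMod p) (Fin r → ZMod p)).2 inferInstance
    have := Fintype.ofFinite (Projectivization (ZMod p) (Fin r → ZMod p))
    have hc := Projectivization.card' (ZMod p) (Fin r → ZMod p)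
    rw [Nat.card_zmod, Nat.card_fun, Nat.card_zmod, Nat.card_fin] at hc
    rw [Nat.clog_le_iff_le_pow hp.one_lt, hc, Nat.add_le_add_iff_right, mul_comm,
      Nat.mul_le_mul_right_iff (by have := hp.two_le; omega)]
    rw [← Nat.cast_le (α := ℕ∞), ← hγ, SimpleGraph.chromaticNumber_le_iff_colorable,
      Nat.card_eq_fintype_card]
    constructor
    · rintro ⟨f, hf⟩
      exact (SimpleGraph.Coloring.mk f (fun {u v} h => hf u v h)).colorable
    · intro h
      let C : G.Coloring (Projectivization (ZMod p) (Fin r → ZMod p)) := h.toColoring (by simp)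
      exact ⟨C, fun u v h => C.valid h⟩
  exact ⟨(key _).2 le_rfl, fun r hr => (key r).1 hr⟩
end

section
/- Let p be a prime and let n ≥ 1, m ≥ 0, k ≥ 0 be integers. Suppose there exists a function f : Fin (m+2) → (ZMod p)^n with all values nonzero such that for every s ≤ k+2 and every injective map j : Fin s → Fin (m+2), the family f ∘ j is linearly independent over ZMod p. Then there exists a function g : Fin (m+1) → (ZMod p)^{n−1} with all values nonzero such that for every s ≤ k+1 and every injective map j : Fin s → Fin (m+1), the family g ∘ j is linearly independent over ZMod p. (This proves s_p(Δ^{m+1}_{(k+1)}) ≤ s_p(Δ^m_{(k)}).) -/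
/-- `s_p(Δ^{m+1}_{(k+1)}) ≤ s_p(Δ^m_{(k)})`: from a nondegenerate simplicial map of
the `(k+1)`-skeleton of the `(m+1)`-simplex to `X(𝔽_p^n)` one constructs a
nondegenerate simplicial map of the `k`-skeleton of the `m`-simplex to `X(𝔽_p^{n−1})`. -/
theorem skeleton_buchstaber_step_down (p : ℕ) (hp : p.Prime) (n m k : ℕ) (hn : 1 ≤ n)
    (f : Fin (m + 2) → Fin n → ZMod p) (hf0 : ∀ i, f i ≠ 0)
    (hf : ∀ s ≤ k + 2, ∀ j : Fin s → Fin (m + 2), Function.Injective j →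
      LinearIndependent (ZMod p) (f ∘ j)) :
    ∃ g : Fin (m + 1) → Fin (n - 1) → ZMod p, (∀ i, g i ≠ 0) ∧
      ∀ s ≤ k + 1, ∀ j : Fin s → Fin (m + 1), Function.Injective j →
        LinearIndependent (ZMod p) (g ∘ j) := by
  haveI : Fact p.Prime := ⟨hp⟩
  let W : Submodule (ZMod p) (Fin n → ZMod p) := Submodule.span (ZMod p) {f 0}
  have hW : Module.finrank (ZMod p) W = 1 := finrank_span_singleton (hf0 0)
  have hQ : Module.finrank (ZMod p) ((Fin n → ZMod p) ⧸ W)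
      = Module.finrank (ZMod p) (Fin (n - 1) → ZMod p) := by
    have h := Submodule.finrank_quotient_add_finrank W
    rw [hW, Module.finrank_fin_fun] at h
    rw [Module.finrank_fin_fun]
    omega
  let e := LinearEquiv.ofFinrankEq _ _ hQ
  let L : (Fin n → ZMod p) →ₗ[ZMod p] (Fin (n - 1) → ZMod p) := e.toLinearMap ∘ₗ W.mkQ
  have hker : LinearMap.ker L = W := by
    simp [L, LinearEquiv.ker_comp]
  have key : ∀ s ≤ k + 1, ∀ j : Fin s → Fin (m + 1), Function.Injective j →
      LinearIndependent (ZMod p) ((fun i : Fin (m + 1) => L (f i.succ)) ∘ j) := by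
    intro s hs j hj
    have h := hf (s + 1) (by omega) (Fin.cons 0 (Fin.succ ∘ j)) (by
      rw [Fin.cons_injective_iff]
      refine ⟨?_, (Fin.succ_injective _).comp hj⟩
      rintro ⟨a, ha⟩
      exact Fin.succ_ne_zero _ ha)
    have hc : f ∘ (Fin.cons 0 (Fin.succ ∘ j) : Fin (s + 1) → Fin (m + 2))
        = Fin.cons (f 0) (f ∘ Fin.succ ∘ j) := by
      funext a
      refine Fin.cases ?_ (fun b => ?_) a <;> simp
    rw [hc, linearIndependent_finCons] at h
    have h2 : LinearIndependent (ZMod p) (L ∘ (f ∘ Fin.succ ∘ j)) := by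
      apply h.1.map
      rw [hker]
      exact (Submodule.disjoint_span_singleton' (hf0 0)).2 h.2
    exact h2
  refine ⟨fun i => L (f i.succ), fun i => ?_, key⟩
  have h := key 1 (by omega) (fun _ => i) (fun a b _ => Subsingleton.elim a b)
  exact h.ne_zero 0
end

section
/- Let p be a prime and let n ≥ 1, m ≥ 0, k ≥ 0 be integers. Suppose there exists a function f : Fin (m+1) → (ZMod p)^n with all values nonzero such that for every s ≤ k+1 and every injective map j : Fin s → Fin (m+1), the family f ∘ j is linearly independent over ZMod p. Then there exists a function g : Fin (m+2) → (ZMod p)^{n+1} with all values nonzero such that for every s ≤ k+1 and every injective map j : Fin s → Fin (m+2), the family g ∘ j is linearly independent over ZMod p. (This proves s_p(Δ^m_{(k)}) ≤ s_p(Δ^{m+1}_{(k)}).) -/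
/-- `s_p(Δ^m_{(k)}) ≤ s_p(Δ^{m+1}_{(k)})`: from a nondegenerate simplicial map of the
`k`-skeleton of the `m`-simplex to `X(𝔽_p^n)` one constructs a nondegenerate
simplicial map of the `k`-skeleton of the `(m+1)`-simplex to `X(𝔽_p^{n+1})`. -/
theorem skeleton_buchstaber_step_up (p : ℕ) (hp : p.Prime) (n m k : ℕ) (hn : 1 ≤ n)
    (f : Fin (m + 1) → Fin n → ZMod p) (hf0 : ∀ i, f i ≠ 0)
    (hf : ∀ s ≤ k + 1, ∀ j : Fin s → Fin (m + 1), Function.Injective j →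
      LinearIndependent (ZMod p) (f ∘ j)) :
    ∃ g : Fin (m + 2) → Fin (n + 1) → ZMod p, (∀ i, g i ≠ 0) ∧
      ∀ s ≤ k + 1, ∀ j : Fin s → Fin (m + 2), Function.Injective j →
        LinearIndependent (ZMod p) (g ∘ j) := by
  haveI : Fact p.Prime := ⟨hp⟩
  have H : ∀ (ι : Type) [Fintype ι], Fintype.card ι ≤ k + 1 → ∀ j : ι → Fin (m + 1),
      Function.Injective j → LinearIndependent (ZMod p) (f ∘ j) := by
    intro ι _ hc j hj
    have h := hf _ hc (j ∘ (Fintype.equivFin ι).symm) (hj.comp (Equiv.injective _))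
    exact (linearIndependent_equiv (Fintype.equivFin ι).symm).1 h
  let g : Fin (m + 2) → Fin (n + 1) → ZMod p :=
    Fin.cons (Fin.cons 1 0) (fun i => Fin.cons 0 (f i))
  have g00 : g 0 0 = 1 := rfl
  have g0s : ∀ x : Fin n, g 0 x.succ = 0 := fun x => rfl
  have gs0 : ∀ i : Fin (m + 1), g i.succ 0 = 0 := fun i => rfl
  have gss : ∀ (i : Fin (m + 1)) (x : Fin n), g i.succ x.succ = f i x := fun i x => rfl
  refine ⟨g, ?_, ?_⟩
  · intro i hi
    induction i using Fin.cases with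
    | zero =>
      have := congrFun hi 0
      rw [g00] at this
      exact one_ne_zero this
    | succ i =>
      apply hf0 i
      funext x
      rw [← gss, hi]
      rfl
  · intro s hs j hj
    rw [Fintype.linearIndependent_iff]
    intro c hc
    have hz : ∀ t, j t = 0 → c t = 0 := by
      intro t ht
      have h := congrFun hc 0
      rw [Finset.sum_apply, Finset.sum_eq_single t] at h
      · simpa [ht, g00] using h
      · intro b _ hb
        have hne : j b ≠ 0 := fun h0 => hb (hj (h0.trans ht.symm))
        obtain ⟨i, hi⟩ := Fin.exists_succ_eq.2 hne
        simp [← hi, gs0]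
      · simp
    have L := H {t // j t ≠ 0}
      ((Fintype.card_subtype_le _).trans (by simpa using hs))
      (fun t => (j t.1).pred t.2)
      (fun a b hab => Subtype.ext (hj (Fin.pred_inj.1 hab)))
    rw [Fintype.linearIndependent_iff] at L
    have L2 := L (fun t => c t.1) (by
      funext x
      have h := congrFun hc x.succ
      rw [Finset.sum_apply] at h ⊢
      rw [← Fintype.sum_subtype_add_sum_subtype (fun t => j t ≠ 0)] at h
      have h2 : ∑ t : {t // ¬ j t ≠ 0}, (c t.1 • (g ∘ j) t.1) x.succ = 0 := by
        apply Finset.sum_eq_zero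
        intro t _
        simp [hz t.1 (not_not.1 t.2)]
      rw [h2, add_zero] at h
      refine Eq.trans (Finset.sum_congr rfl ?_) h
      intro t _
      have := gss ((j t.1).pred t.2) x
      rw [Fin.succ_pred] at this
      simp [this])
    intro t
    by_cases ht : j t = 0
    · exact hz t ht
    · exact L2 ⟨t, ht⟩
end
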